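/- The function y_B(w,z) = 1/(2(z - 1/2 - w)) · (1 + (z-1)/√(2(z²/2 - w))) satisfies the partial differential equation ∂²y_B/∂z² + (1+z)·∂²y_B/∂z∂w + z·∂²y_B/∂w² = 0 at all points (w,z) where z - 1/2 - w ≠ 0 and z²/2 - w lies off the branch cut (e.g. Re(z²/2 - w) > 0). -/

import Mathlib

open Complex

noncomputable def yB (w z : ℂ) : ℂ :=
  1 / (2 * (z - 1/2 - w)) * (1 + (z - 1) / (2 * (z^2/2 - w)) ^ ((1:ℂ)/2))

noncomputable def sqrtB (w z : ℂ) : ℂ := (2 * (z^2/2 - w)) ^ ((1:ℂ)/2)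

theorem two_mul_mem_slitPlane {s : ℂ} (h : 0 < s.re) : 2 * s ∈ slitPlane := by
  left
  simpa using h

theorem sqrtB_sq (w z : ℂ) : sqrtB w z ^ 2 = z^2 - 2 * w := by
  have h := cpow_nat_inv_pow (2 * (z^2/2 - w)) two_ne_zero
  rw [sqrtB, one_div]
  push_cast at h
  rw [h]
  ring

theorem sqrtB_ne_zero {w z : ℂ} (h : 0 < (z^2/2 - w).re) : sqrtB w z ≠ 0 := by
  intro h0
  have hs := sqrtB_sq w z
  rw [h0] at hs
  have : z^2/2 - w = 0 := by linear_combination -hs / 2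
  simp [this] at h

theorem cpow_half_sub_one (s : ℂ) :
    s ^ ((1:ℂ)/2 - 1) = (s ^ ((1:ℂ)/2))⁻¹ := by
  rw [← cpow_neg]
  norm_num

theorem hasDerivAt_sqrtB_z {w z : ℂ} (h : 0 < (z^2/2 - w).re) :
    HasDerivAt (fun z' => sqrtB w z') (z / sqrtB w z) z := by
  have hm := two_mul_mem_slitPlane h
  have hp : HasDerivAt (fun z' : ℂ => 2 * (z'^2/2 - w)) (2 * z) z := by
    refine ((((hasDerivAt_id' z).fun_pow 2).div_const 2).sub_const w |>.const_mul 2).congr_deriv ?_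
    norm_num
  refine (hp.cpow_const (c := (1:ℂ)/2) hm).congr_deriv ?_
  rw [cpow_half_sub_one, ← sqrtB]
  ring

theorem hasDerivAt_sqrtB_w {w z : ℂ} (h : 0 < (z^2/2 - w).re) :
    HasDerivAt (fun w' => sqrtB w' z) (-1 / sqrtB w z) w := by
  have hm := two_mul_mem_slitPlane h
  have hp : HasDerivAt (fun w' : ℂ => 2 * (z^2/2 - w')) (-2) w := by
    refine (((hasDerivAt_id' w).const_sub (z^2/2)).const_mul 2).congr_deriv ?_
    norm_num
  refine (hp.cpow_const (c := (1:ℂ)/2) hm).congr_deriv ?_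
  rw [cpow_half_sub_one, ← sqrtB]
  ring

theorem hasDerivAt_yB_z {w z : ℂ} (h1 : z - 1/2 - w ≠ 0) (h2 : 0 < (z^2/2 - w).re) :
    HasDerivAt (fun z' => yB w z')
      (-(1 + (z - 1) / sqrtB w z) / (2 * (z - 1/2 - w)^2)
        + (1 / sqrtB w z - (z - 1) * z / sqrtB w z ^ 3) / (2 * (z - 1/2 - w))) z := by
  have hq := sqrtB_ne_zero h2
  have hd := (((hasDerivAt_id' z).sub_const (1/2)).sub_const w).const_mul 2
  have hn := (((hasDerivAt_id' z).sub_const 1).fun_div (hasDerivAt_sqrtB_z h2) hq).const_add 1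
  refine (((hasDerivAt_const z (1:ℂ)).fun_div hd (mul_ne_zero two_ne_zero h1)).fun_mul
    hn).congr_deriv ?_
  generalize sqrtB w z = q at *
  obtain ⟨d, hdd⟩ : ∃ d, d = z - 1/2 - w := ⟨_, rfl⟩
  rw [← hdd] at h1 ⊢
  field_simp
  ring

theorem hasDerivAt_yB_w {w z : ℂ} (h1 : z - 1/2 - w ≠ 0) (h2 : 0 < (z^2/2 - w).re) :
    HasDerivAt (fun w' => yB w' z)
      ((1 + (z - 1) / sqrtB w z) / (2 * (z - 1/2 - w)^2)
        + (z - 1) / sqrtB w z ^ 3 / (2 * (z - 1/2 - w))) w := by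
  have hq := sqrtB_ne_zero h2
  have hd := ((hasDerivAt_id' w).const_sub (z - 1/2)).const_mul 2
  have hn := ((hasDerivAt_const w (z - 1)).fun_div (hasDerivAt_sqrtB_w h2) hq).const_add 1
  refine (((hasDerivAt_const w (1:ℂ)).fun_div hd (mul_ne_zero two_ne_zero h1)).fun_mul
    hn).congr_deriv ?_
  generalize sqrtB w z = q at *
  obtain ⟨d, hdd⟩ : ∃ d, d = z - 1/2 - w := ⟨_, rfl⟩
  rw [← hdd] at h1 ⊢
  field_simp
  ring

theorem stmt_0 (w z : ℂ) (h1 : z - 1/2 - w ≠ 0) (h2 : 0 < (z^2/2 - w).re) :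
    deriv (fun z' => deriv (fun z'' => yB w z'') z') z
      + (1 + z) * deriv (fun w' => deriv (fun z' => yB w' z') z) w
      + z * deriv (fun w' => deriv (fun w'' => yB w'' z) w') w = 0 := by
  have hq := sqrtB_ne_zero h2
  have hqz := hasDerivAt_sqrtB_z h2
  have hqw := hasDerivAt_sqrtB_w h2
  have ez : ∀ᶠ z' in nhds z, z' - 1/2 - w ≠ 0 ∧ 0 < (z'^2/2 - w).re :=
    ((by fun_prop : ContinuousAt (fun z' : ℂ => z' - 1/2 - w) z).eventually_ne h1).and
      ((by fun_prop : ContinuousAt (fun z' : ℂ => (z'^2/2 - w).re) z).eventually (lt_mem_nhds h2))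
  have ew : ∀ᶠ w' in nhds w, z - 1/2 - w' ≠ 0 ∧ 0 < (z^2/2 - w').re :=
    ((by fun_prop : ContinuousAt (fun w' : ℂ => z - 1/2 - w') w).eventually_ne h1).and
      ((by fun_prop : ContinuousAt (fun w' : ℂ => (z^2/2 - w').re) w).eventually (lt_mem_nhds h2))
  have hdz : HasDerivAt (fun z' : ℂ => z' - 1/2 - w) 1 z :=
    ((hasDerivAt_id' z).sub_const (1/2)).sub_const w
  have hdw : HasDerivAt (fun w' : ℂ => z - 1/2 - w') (-1) w :=
    (hasDerivAt_id' w).const_sub (z - 1/2)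
  have hz1 : HasDerivAt (fun z' : ℂ => z' - 1) 1 z := (hasDerivAt_id' z).sub_const 1
  have hd1 : 2 * (z - 1/2 - w) ≠ 0 := mul_ne_zero two_ne_zero h1
  have hd2 : 2 * (z - 1/2 - w)^2 ≠ 0 := mul_ne_zero two_ne_zero (pow_ne_zero 2 h1)
  have hq3 : sqrtB w z ^ 3 ≠ 0 := pow_ne_zero 3 hq
  have zz := ((((hz1.fun_div hqz hq).const_add 1).fun_neg.fun_div
      ((hdz.fun_pow 2).const_mul 2) hd2).fun_add
    ((((hasDerivAt_const z (1:ℂ)).fun_div hqz hq).fun_sub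
      ((hz1.fun_mul (hasDerivAt_id' z)).fun_div (hqz.fun_pow 3) hq3)).fun_div
      (hdz.const_mul 2) hd1))
  have zw := (((((hasDerivAt_const w (z - 1)).fun_div hqw hq).const_add 1).fun_neg.fun_div
      ((hdw.fun_pow 2).const_mul 2) hd2).fun_add
    ((((hasDerivAt_const w (1:ℂ)).fun_div hqw hq).fun_sub
      ((hasDerivAt_const w ((z - 1) * z)).fun_div (hqw.fun_pow 3) hq3)).fun_div
      (hdw.const_mul 2) hd1))
  have ww := (((((hasDerivAt_const w (z - 1)).fun_div hqw hq).const_add 1).fun_div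
      ((hdw.fun_pow 2).const_mul 2) hd2).fun_add
    (((hasDerivAt_const w (z - 1)).fun_div (hqw.fun_pow 3) hq3).fun_div
      (hdw.const_mul 2) hd1))
  rw [(zz.congr_of_eventuallyEq (ez.mono fun z' h => (hasDerivAt_yB_z h.1 h.2).deriv)).deriv,
    (zw.congr_of_eventuallyEq (ew.mono fun w' h => (hasDerivAt_yB_z h.1 h.2).deriv)).deriv,
    (ww.congr_of_eventuallyEq (ew.mono fun w' h => (hasDerivAt_yB_w h.1 h.2).deriv)).deriv]
  have hs := sqrtB_sq w z
  clear zz zw ww hqz hqw hdz hdw hz1 ez ew hd1 hd2 hq3 h2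
  generalize sqrtB w z = q at *
  obtain ⟨d, hdd⟩ : ∃ d, d = z - 1/2 - w := ⟨_, rfl⟩
  rw [← hdd] at h1 ⊢
  have hd : q^2 = (z-1)^2 + 2 * d := by linear_combination hs - 2 * hdd
  clear hs hdd
  obtain rfl : d = (q^2 - (z-1)^2) / 2 := by linear_combination -hd/2
  have h1' : q^2 - (z-1)^2 ≠ 0 := fun h => h1 (by rw [h]; simp)
  simp only [Nat.cast_ofNat]
  field_simp
  ring
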